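/- Let k ≥ 1 and n = 2k + 1. For every choice of generic eigenvalues compatible with the triple of multiplicity vectors OG_k : Λ₁ = (2,…,2,1) (k twos and one 1), Λ₂ = (2,…,2,1,1,1) (k−1 twos and three 1s), Λ₃ = (2k−1, 1, 1), there exists an irreducible triple of diagonalizable matrices A₁, A₂, A₃ ∈ gl(n,ℂ) with A₁ + A₂ + A₃ = 0, where A_j has distinct eigenvalues with multiplicities given by Λ_j equal to the chosen generic eigenvalues. (This triple of multiplicity vectors is rigid: d₁ + d₂ + d₃ = 2n² − 2.) -/

import Mathlib

open Matrix BigOperators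

/-- `B` lies in the conjugacy class of `A` (conjugation by an invertible matrix). -/
def MatConj {n : ℕ} (A B : Matrix (Fin n) (Fin n) ℂ) : Prop :=
  ∃ S : (Matrix (Fin n) (Fin n) ℂ)ˣ, B = S.val * A * (S⁻¹).val

/-- A tuple of `n × n` matrices is irreducible if no subspace of `ℂⁿ` other than `⊥` and `⊤`
is invariant under all of them. -/
def IrreducibleTuple {q n : ℕ} (M : Fin q → Matrix (Fin n) (Fin n) ℂ) : Prop :=
  ∀ V : Submodule ℂ (Fin n → ℂ),
    (∀ j, V.map (Matrix.mulVecLin (M j)) ≤ V) → V = ⊥ ∨ V = ⊤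

/-- The multiset of multiplicities of the distinct values of `d : Fin n → ℂ`
(the multiplicity vector of the diagonal matrix with diagonal `d`). -/
noncomputable def evCounts {n : ℕ} (d : Fin n → ℂ) : Multiset ℕ := by
  classical exact (Finset.univ.image d).val.map fun σ => (Finset.univ.filter fun k => d k = σ).card

/-- Genericity of the eigenvalue families `d j` (eigenvalues listed with multiplicity):
no partial sums, with `κ` eigenvalues chosen from each family, `1 ≤ κ ≤ n-1`, vanish. -/
def GenericAddEV {q n : ℕ} (d : Fin q → Fin n → ℂ) : Prop :=
  ∀ κ : ℕ, 1 ≤ κ → κ ≤ n - 1 →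
    ∀ Φ : Fin q → Finset (Fin n), (∀ j, (Φ j).card = κ) →
      (∑ j, ∑ k ∈ Φ j, d j k) ≠ 0

open Polynomial in
lemma pf_sum (S : Finset ℂ) (g : ℂ[X]) (hg : g.degree < S.card) :
    ∑ s ∈ S, Lagrange.nodalWeight S id s * g.eval s = g.coeff (S.card - 1) := by
  rw [Lagrange.coeff_eq_sum (s := S) (v := id) (Set.injOn_id _) hg]
  refine Finset.sum_congr rfl fun s _ => ?_
  simp [Lagrange.nodalWeight, div_eq_mul_inv, mul_comm]

open Polynomial in
lemma pf_eval (S : Finset ℂ) (g : ℂ[X]) (hg : g.degree < S.card) (z : ℂ) (hz : z ∉ S) :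
    ∑ s ∈ S, (z - s)⁻¹ * (Lagrange.nodalWeight S id s * g.eval s)
      = g.eval z / (Lagrange.nodal S id).eval z := by
  have hz' : ∀ i ∈ S, z ≠ id i := fun i hi h => hz (by rw [h]; exact hi)
  have hW := Lagrange.eval_nodal_not_at_node (s := S) (v := id) (x := z) hz'
  rw [eq_div_iff hW]
  conv_rhs => rw [Lagrange.eq_interpolate (s := S) (v := id) (Set.injOn_id _) hg]
  rw [Lagrange.eval_interpolate_not_at_node _ hz', mul_comm]
  congr 1
  refine Finset.sum_congr rfl fun s _ => ?_
  simp only [id]; ring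

open Polynomial in
/-- diagonal case -/
lemma pf_diag (S T : Finset ℂ) (hc : T.card + 2 = S.card) (s p : ℂ) :
    (∑ x ∈ S, -Lagrange.nodalWeight S id x * ((∏ t ∈ T, (x - t)) * (x ^ 2 + s * x + p))
      = -(∑ x ∈ S, x) + (∑ t ∈ T, t) - s) ∧
    ∀ z ∉ S, 1 - ∑ x ∈ S, (z - x)⁻¹ *
        (-Lagrange.nodalWeight S id x * ((∏ t ∈ T, (x - t)) * (x ^ 2 + s * x + p)))
      = (∏ t ∈ T, (z - t)) * (z ^ 2 + s * z + p) / (Lagrange.nodal S id).eval z := by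
  set W : ℂ[X] := Lagrange.nodal S id with hW
  set N : ℂ[X] := X ^ 2 + C s * X + C p with hN
  set R : ℂ[X] := Lagrange.nodal T id with hR
  have hNm : N.Monic := by rw [hN]; monicity!
  have hNd : N.natDegree = 2 := by rw [hN]; compute_degree!
  have hRm : R.Monic := Lagrange.nodal_monic
  have hWm : W.Monic := Lagrange.nodal_monic
  have hQm : (R * N).Monic := hRm.mul hNm
  have hQd : (R * N).natDegree = S.card := by
    rw [hRm.natDegree_mul hNm, hNd, Lagrange.natDegree_nodal, hc]
  have hWd : W.natDegree = S.card := Lagrange.natDegree_nodal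
  have hg : (W - R * N).degree < S.card := by
    have := degree_sub_lt_left (p := W) (q := R * N) ?_ hWm.ne_zero ?_
    · rwa [Lagrange.degree_nodal] at this
    · rw [degree_eq_natDegree hWm.ne_zero, degree_eq_natDegree hQm.ne_zero, hQd, hWd]
    · rw [hWm.leadingCoeff, hQm.leadingCoeff]
  have hRev : ∀ z, R.eval z = ∏ t ∈ T, (z - t) := fun z => by
    rw [hR, Lagrange.eval_nodal]; rfl
  have hNev : ∀ z, N.eval z = z ^ 2 + s * z + p := fun z => by simp [hN]
  have hev : ∀ x ∈ S, -Lagrange.nodalWeight S id x * ((∏ t ∈ T, (x - t)) * (x ^ 2 + s * x + p))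
      = Lagrange.nodalWeight S id x * (W - R * N).eval x := by
    intro x hx
    have : W.eval x = 0 := Lagrange.eval_nodal_at_node (v := id) hx
    rw [eval_sub, eval_mul, this, hRev, hNev]; ring
  have nx : ∀ U : Finset ℂ, (Lagrange.nodal U id : ℂ[X]).nextCoeff = - ∑ t ∈ U, t := by
    intro U
    exact prod_X_sub_C_nextCoeff (s := U) (fun x => x)
  constructor
  · rw [Finset.sum_congr rfl hev, pf_sum S _ hg, coeff_sub]
    have h1 : W.coeff (S.card - 1) = W.nextCoeff := by
      rw [nextCoeff_of_natDegree_pos (by omega), hWd]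
    have h2 : (R * N).coeff (S.card - 1) = (R * N).nextCoeff := by
      rw [nextCoeff_of_natDegree_pos (by omega), hQd]
    have h3 : N.nextCoeff = s := by
      rw [nextCoeff_of_natDegree_pos (by omega), hNd]
      simp [hN, coeff_C, coeff_X_pow]
    rw [h1, h2, hRm.nextCoeff_mul hNm, h3, nx, nx]; ring
  · intro z hz
    have hz' : ∀ i ∈ S, z ≠ id i := fun i hi h => hz (by rw [h]; exact hi)
    have hW0 : W.eval z ≠ 0 := Lagrange.eval_nodal_not_at_node (s := S) (v := id) (x := z) hz'
    have : ∑ x ∈ S, (z - x)⁻¹ *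
        (-Lagrange.nodalWeight S id x * ((∏ t ∈ T, (x - t)) * (x ^ 2 + s * x + p)))
        = (W - R * N).eval z / W.eval z := by
      rw [← pf_eval S _ hg z hz]
      exact Finset.sum_congr rfl fun x hx => by rw [hev x hx]
    rw [this, eval_sub, eval_mul, hRev, hNev]
    field_simp
    ring

open Polynomial in
/-- off-diagonal case -/
lemma pf_off (S T : Finset ℂ) (hc : T.card + 2 = S.card) (r : ℂ) :
    (∑ x ∈ S, -Lagrange.nodalWeight S id x * ((∏ t ∈ T, (x - t)) * r) = 0) ∧
    ∀ z ∉ S, - ∑ x ∈ S, (z - x)⁻¹ *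
        (-Lagrange.nodalWeight S id x * ((∏ t ∈ T, (x - t)) * r))
      = (∏ t ∈ T, (z - t)) * r / (Lagrange.nodal S id).eval z := by
  set g : ℂ[X] := - (Lagrange.nodal T id * C r) with hgd
  have hgn : g.natDegree ≤ T.card := by
    rw [hgd, natDegree_neg]
    refine (natDegree_mul_le).trans ?_
    simp
  have hg : g.degree < S.card := by
    refine lt_of_le_of_lt (degree_le_of_natDegree_le hgn) ?_
    exact_mod_cast (by omega : T.card < S.card)
  have hev : ∀ z, g.eval z = - ((∏ t ∈ T, (z - t)) * r) := fun z => by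
    rw [hgd, eval_neg, eval_mul, eval_C, Lagrange.eval_nodal]; rfl
  have hev' : ∀ x ∈ S, -Lagrange.nodalWeight S id x * ((∏ t ∈ T, (x - t)) * r)
      = Lagrange.nodalWeight S id x * g.eval x := by
    intro x _; rw [hev]; ring
  constructor
  · rw [Finset.sum_congr rfl hev', pf_sum S _ hg]
    exact coeff_eq_zero_of_natDegree_lt (by omega)
  · intro z hz
    have : ∑ x ∈ S, (z - x)⁻¹ *
        (-Lagrange.nodalWeight S id x * ((∏ t ∈ T, (x - t)) * r))
        = g.eval z / (Lagrange.nodal S id).eval z := by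
      rw [← pf_eval S _ hg z hz]
      exact Finset.sum_congr rfl fun x hx => by rw [hev' x hx]
    rw [this, hev, neg_div, neg_neg]

/-- solving for the quadratic matrix polynomial -/
lemma quad_exists (s1 s2 x0 x1 x2 x3 : ℂ) (hs : s1 ≠ s2) (htr : s1 + s2 = -(x0 + x1 + x2 + x3)) :
    ∃ p q r : ℂ, ∀ z, (z ^ 2 + s1 * z + p) * (z ^ 2 + s2 * z + q) - r * 1
      = (z - x0) * (z - x1) * (z - x2) * (z - x3) := by
  have hs' : s1 - s2 ≠ 0 := sub_ne_zero.mpr hs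
  obtain ⟨e2, he2⟩ : ∃ e, e = x0*x1+x0*x2+x0*x3+x1*x2+x1*x3+x2*x3 := ⟨_, rfl⟩
  obtain ⟨e3, he3⟩ : ∃ e, e = x0*x1*x2+x0*x1*x3+x0*x2*x3+x1*x2*x3 := ⟨_, rfl⟩
  -- p + q = e2 - s1 s2 ; s1 q + s2 p = - e3
  obtain ⟨q, hq⟩ : ∃ q, (s1 - s2) * q = -e3 - s2 * (e2 - s1 * s2) :=
    ⟨(-e3 - s2 * (e2 - s1 * s2)) / (s1 - s2), by field_simp⟩
  refine ⟨e2 - s1 * s2 - q, q, (e2 - s1 * s2 - q) * q - x0*x1*x2*x3, fun z => ?_⟩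
  linear_combination z * hq + z^3 * htr + z^2 * he2 - z * he3

lemma exists_residues (S T : Finset ℂ) (hc : T.card + 2 = S.card) (l0 n1 n2 n3 a b : ℂ)
    (hab : a ≠ b)
    (hT : ∀ t ∈ T, t ∉ S) (h1 : n1 ∉ S) (h2 : n2 ∉ S) (h3 : n3 ∉ S)
    (htr : 2 * (∑ x ∈ S, x) - l0 + a + b = 2 * (∑ t ∈ T, t) + n1 + n2 + n3) :
    ∃ P : ℂ → Matrix (Fin 2) (Fin 2) ℂ, (∑ x ∈ S, P x = !![a, 0; 0, b]) ∧ (P l0).det = 0 ∧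
      (∀ t ∈ T, 1 - ∑ x ∈ S, (t - x)⁻¹ • P x = 0) ∧
      (∀ z, z = n1 ∨ z = n2 ∨ z = n3 → (1 - ∑ x ∈ S, (z - x)⁻¹ • P x).det = 0) := by
  obtain ⟨s1, hs1⟩ : ∃ s, s = -(∑ x ∈ S, x) + (∑ t ∈ T, t) - a := ⟨_, rfl⟩
  obtain ⟨s2, hs2⟩ : ∃ s, s = -(∑ x ∈ S, x) + (∑ t ∈ T, t) - b := ⟨_, rfl⟩
  have hs : s1 ≠ s2 := by
    intro h; apply hab; linear_combination hs1 - hs2 - h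
  obtain ⟨p, q, r, hq⟩ := quad_exists s1 s2 l0 n1 n2 n3 hs
    (by linear_combination hs1 + hs2 - htr)
  let Pf : ℂ → ℂ := fun x => ∏ t ∈ T, (x - t)
  let w : ℂ → ℂ := fun x => -Lagrange.nodalWeight S id x
  let P : ℂ → Matrix (Fin 2) (Fin 2) ℂ := fun x =>
    !![w x * (Pf x * (x ^ 2 + s1 * x + p)), w x * (Pf x * r);
       w x * (Pf x * 1), w x * (Pf x * (x ^ 2 + s2 * x + q))]
  obtain ⟨d1, e1⟩ := pf_diag S T hc s1 p
  obtain ⟨d2, e2⟩ := pf_diag S T hc s2 q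
  obtain ⟨o1, f1⟩ := pf_off S T hc r
  obtain ⟨o2, f2⟩ := pf_off S T hc 1
  have key : ∀ z ∉ S, 1 - ∑ x ∈ S, (z - x)⁻¹ • P x =
      (Pf z / (Lagrange.nodal S id).eval z) •
        !![z ^ 2 + s1 * z + p, r; 1, z ^ 2 + s2 * z + q] := by
    intro z hz
    ext i j
    fin_cases i <;> fin_cases j
    · simp only [Matrix.sub_apply, Matrix.sum_apply, Matrix.smul_apply, smul_eq_mul]
      refine (e1 z hz).trans ?_
      simp [Pf]; ring
    · simp only [Matrix.sub_apply, Matrix.sum_apply, Matrix.smul_apply, smul_eq_mul]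
      refine (zero_sub _).trans ((f1 z hz).trans ?_)
      simp [Pf]; ring
    · simp only [Matrix.sub_apply, Matrix.sum_apply, Matrix.smul_apply, smul_eq_mul]
      refine (zero_sub _).trans ((f2 z hz).trans ?_)
      simp [Pf]
    · simp only [Matrix.sub_apply, Matrix.sum_apply, Matrix.smul_apply, smul_eq_mul]
      refine (e2 z hz).trans ?_
      simp [Pf]; ring
  refine ⟨P, ?_, ?_, ?_, ?_⟩
  · ext i j
    fin_cases i <;> fin_cases j
    · rw [Matrix.sum_apply]
      refine d1.trans ?_
      simp [hs1]
    · rw [Matrix.sum_apply]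
      exact o1
    · rw [Matrix.sum_apply]
      exact o2
    · rw [Matrix.sum_apply]
      refine d2.trans ?_
      simp [hs2]
  · have := hq l0
    simp only [P, Matrix.det_fin_two_of]
    linear_combination (w l0 * Pf l0) ^ 2 * this
  · intro t ht
    rw [key t (hT t ht)]
    have : Pf t = 0 := Finset.prod_eq_zero ht (sub_self t)
    simp [this]
  · intro z hz
    have hzS : z ∉ S := by rcases hz with rfl | rfl | rfl <;> assumption
    rw [key z hzS, Matrix.det_smul, Matrix.det_fin_two_of, hq z]
    rcases hz with rfl | rfl | rfl <;> simp

lemma matConj_of_finrank {n : ℕ} (A : Matrix (Fin n) (Fin n) ℂ) (d : Fin n → ℂ)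
    (h : ∀ i, (Finset.univ.filter fun k => d k = d i).card ≤
      Module.finrank ℂ (Module.End.eigenspace (Matrix.mulVecLin A) (d i))) :
    MatConj (Matrix.diagonal d) A := by
  classical
  have h' : ∀ σ : ℂ, ∃ v : {k // d k = σ} → Module.End.eigenspace (Matrix.mulVecLin A) σ,
      LinearIndependent ℂ v := by
    intro σ
    by_cases hσ : ∃ i, d i = σ
    · obtain ⟨i, rfl⟩ := hσ
      have hc : Fintype.card {k // d k = d i} ≤
          Module.finrank ℂ (Module.End.eigenspace (Matrix.mulVecLin A) (d i)) := by
        rw [Fintype.card_subtype]; exact h i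
      obtain ⟨f, hf⟩ := exists_linearIndependent_of_le_finrank hc
      exact ⟨f ∘ Fintype.equivFin _, hf.comp _ (Equiv.injective _)⟩
    · have : IsEmpty {k // d k = σ} := ⟨fun k => hσ ⟨k.1, k.2⟩⟩
      exact ⟨fun k => 0, linearIndependent_empty_type⟩
  choose v hv using h'
  let b : Fin n → (Fin n → ℂ) := fun k => (v (d k) ⟨k, rfl⟩ : Fin n → ℂ)
  have hb : ∀ k, A *ᵥ b k = d k • b k := fun k => by
    have := (v (d k) ⟨k, rfl⟩).2
    rw [Module.End.mem_eigenspace_iff] at this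
    exact this
  have hbv : ∀ σ (k : {k // d k = σ}), b k.1 = v σ k := by
    rintro σ ⟨k, rfl⟩; rfl
  have hli : LinearIndependent ℂ b := by
    rw [Fintype.linearIndependent_iff]
    intro g hg i
    have hind := (iSupIndep_iff_finsetSum_eq_zero_imp_eq_zero _).1
      (Module.End.eigenspaces_iSupIndep (Matrix.mulVecLin A))
    let w : ℂ → (Fin n → ℂ) := fun σ => ∑ k ∈ Finset.univ.filter (fun k => d k = σ), g k • b k
    have hw : ∀ σ, w σ ∈ Module.End.eigenspace (Matrix.mulVecLin A) σ := by
      intro σ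
      refine Submodule.sum_mem _ fun k hk => Submodule.smul_mem _ _ ?_
      have hk' : d k = σ := (Finset.mem_filter.1 hk).2
      subst hk'
      exact (v (d k) ⟨k, rfl⟩).2
    have hsum : ∑ σ ∈ Finset.univ.image d, w σ = 0 := by
      rw [← hg]
      exact Finset.sum_fiberwise_of_maps_to (fun k _ => Finset.mem_image_of_mem d (Finset.mem_univ k)) _
    have h0 : w (d i) = 0 := 
      hind (Finset.univ.image d) w (fun σ _ => hw σ) hsum (d i)
        (Finset.mem_image_of_mem d (Finset.mem_univ i))
    have h1 : ∑ k : {k // d k = d i}, g k.1 • v (d i) k = 0 := by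
      apply Subtype.ext
      rw [Submodule.coe_sum, Submodule.coe_zero, ← h0]
      simp only [w]
      rw [Finset.sum_subtype (p := fun k => d k = d i) _ (by simp)]
      refine Finset.sum_congr rfl fun k _ => ?_
      rw [hbv]; rfl
    exact (Fintype.linearIndependent_iff.1 (hv (d i))) (fun k => g k.1) h1 ⟨i, rfl⟩
  let S : Matrix (Fin n) (Fin n) ℂ := (Matrix.of b)ᵀ
  have hS : IsUnit S := by
    rw [← Matrix.linearIndependent_cols_iff_isUnit]
    exact hli
  obtain ⟨S', hS'⟩ := hS
  refine ⟨S', ?_⟩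
  have hAS : A * S = S * Matrix.diagonal d := by
    ext i k
    rw [Matrix.mul_diagonal]
    have := congrFun (hb k) i
    simp only [Pi.smul_apply, smul_eq_mul] at this
    rw [mul_comm (S i k)]
    exact this
  rw [hS', ← hAS, ← hS', mul_assoc, Units.mul_inv, mul_one]

lemma matConj_quot_trace {n : ℕ} (A : Matrix (Fin n) (Fin n) ℂ) (d : Fin n → ℂ)
    (h : MatConj (Matrix.diagonal d) A) (V : Submodule ℂ (Fin n → ℂ))
    (hV : V ≤ V.comap (Matrix.mulVecLin A)) :
    ∃ Φ : Finset (Fin n), Φ.card = Module.finrank ℂ ((Fin n → ℂ) ⧸ V) ∧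
      LinearMap.trace ℂ _ (V.mapQ V (Matrix.mulVecLin A) hV) = ∑ k ∈ Φ, d k := by
  classical
  obtain ⟨S, rfl⟩ := h
  set A := S.val * Matrix.diagonal d * (S⁻¹).val with hA
  have hAS : A * S.val = S.val * Matrix.diagonal d := by
    rw [hA, mul_assoc, Units.inv_mul, mul_one]
  let b : Fin n → (Fin n → ℂ) := fun k => S.val.col k
  have hb : ∀ k, A *ᵥ b k = d k • b k := fun k => by
    ext i
    have := congrFun (congrFun hAS i) k
    rw [Matrix.mul_diagonal, mul_comm (S.val i k)] at this
    exact this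
  have hli : LinearIndependent ℂ b := Matrix.linearIndependent_cols_iff_isUnit.2 S.isUnit
  have hsp : Submodule.span ℂ (Set.range b) = ⊤ :=
    hli.span_eq_top_of_card_eq_finrank' (by simp)
  obtain ⟨κ, a, ha, hspan, hind⟩ := exists_linearIndependent' ℂ (fun k => V.mkQ (b k))
  have htop : Submodule.span ℂ (Set.range fun k => V.mkQ (b k)) = ⊤ := by
    have : (Set.range fun k => V.mkQ (b k)) = Set.image V.mkQ (Set.range b) := by
      rw [← Set.range_comp]; rfl
    rw [this, Submodule.span_image, hsp, Submodule.map_top, Submodule.range_mkQ]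
  have : Fintype κ := Fintype.ofInjective a ha
  let B := Module.Basis.mk hind (by rw [hspan, htop])
  refine ⟨Finset.univ.image a, ?_, ?_⟩
  · rw [Finset.card_image_of_injective _ ha, Module.finrank_eq_card_basis B]; rfl
  · rw [LinearMap.trace_eq_matrix_trace ℂ B, Finset.sum_image (fun x _ y _ hxy => ha hxy),
      Matrix.trace]
    refine Finset.sum_congr rfl fun k _ => ?_
    have hBk : B k = V.mkQ (b (a k)) := by simp [B]
    rw [Matrix.diag_apply, LinearMap.toMatrix_apply]
    have : V.mapQ V (Matrix.mulVecLin A) hV (B k) = d (a k) • B k := by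
      rw [hBk, Submodule.mkQ_apply, Submodule.mapQ_apply, Matrix.mulVecLin_apply, hb,
        Submodule.Quotient.mk_smul]
    rw [this, map_smul]
    simp

lemma irreducible_of_generic {n : ℕ} (d : Fin 3 → Fin n → ℂ)
    (hgen : GenericAddEV d) (A : Fin 3 → Matrix (Fin n) (Fin n) ℂ) (hA : ∑ j, A j = 0)
    (hc : ∀ j, MatConj (Matrix.diagonal (d j)) (A j)) : IrreducibleTuple A := by
  intro V hV
  by_contra hcon
  push Not at hcon
  have hV' : ∀ j, V ≤ V.comap (Matrix.mulVecLin (A j)) := fun j =>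
    Submodule.map_le_iff_le_comap.1 (hV j)
  choose Φ hΦ htr using fun j => matConj_quot_trace (A j) (d j) (hc j) V (hV' j)
  have hfr := Submodule.finrank_quotient_add_finrank V
  rw [Module.finrank_fin_fun] at hfr
  have hpos : 0 < Module.finrank ℂ V := by
    rw [Nat.pos_iff_ne_zero]
    intro h; exact hcon.1 (Submodule.finrank_eq_zero.1 h)
  have hlt : Module.finrank ℂ V < n := by
    have := Submodule.finrank_lt hcon.2
    rwa [Module.finrank_fin_fun] at this
  refine hgen (Module.finrank ℂ ((Fin n → ℂ) ⧸ V)) (by omega) (by omega) Φ hΦ ?_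
  rw [← Finset.sum_congr rfl fun j _ => htr j, ← map_sum]
  have : ∑ j, V.mapQ V (Matrix.mulVecLin (A j)) (hV' j) = 0 := by
    apply LinearMap.ext
    intro x
    obtain ⟨y, rfl⟩ := V.mkQ_surjective x
    simp only [LinearMap.sum_apply, Submodule.mkQ_apply, Submodule.mapQ_apply,
      Matrix.mulVecLin_apply, LinearMap.zero_apply]
    simp_rw [← Submodule.mkQ_apply]
    rw [← map_sum, ← Matrix.sum_mulVec, hA, Matrix.zero_mulVec, map_zero]
  rw [this, map_zero]

lemma rank_one_of_det {P : Matrix (Fin 2) (Fin 2) ℂ} (h : P.det = 0) :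
    ∃ v u : Fin 2 → ℂ, Matrix.vecMulVec v u = P := by
  rw [Matrix.det_fin_two] at h
  by_cases h0 : P 0 0 = 0
  · by_cases h1 : P 0 1 = 0
    · refine ⟨![0, 1], P 1, ?_⟩
      ext i j
      fin_cases i <;> fin_cases j <;> simp [Matrix.vecMulVec_apply, h0, h1]
    · refine ⟨![1, P 1 1 / P 0 1], P 0, ?_⟩
      ext i j
      fin_cases i <;> fin_cases j <;> simp [Matrix.vecMulVec_apply, h1]
      have : P 0 1 * P 1 0 = 0 := by rw [h0] at h; linear_combination -h
      rcases mul_eq_zero.1 this with h2 | h2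
      · exact absurd h2 h1
      · rw [h0, h2]; simp
  · refine ⟨![1, P 1 0 / P 0 0], P 0, ?_⟩
    ext i j
    fin_cases i <;> fin_cases j <;> simp [Matrix.vecMulVec_apply, h0]
    field_simp
    linear_combination -h

lemma fiber_factor {n : ℕ} (F : Finset (Fin n)) (P : Matrix (Fin 2) (Fin 2) ℂ)
    (h : F.card = 2 ∨ (F.card = 1 ∧ P.det = 0)) :
    ∃ v u : Fin n → Fin 2 → ℂ, ∑ k ∈ F, Matrix.vecMulVec (v k) (u k) = P := by
  classical
  rcases h with h | ⟨h, hd⟩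
  · obtain ⟨p, q, hpq, rfl⟩ := Finset.card_eq_two.1 h
    refine ⟨fun k => if k = p then ![1, 0] else ![0, 1], fun k => if k = p then P 0 else P 1, ?_⟩
    rw [Finset.sum_pair hpq]
    ext i j
    rw [Matrix.add_apply, Matrix.vecMulVec_apply, Matrix.vecMulVec_apply]
    fin_cases i <;> fin_cases j <;> simp [hpq.symm]
  · obtain ⟨p, rfl⟩ := Finset.card_eq_one.1 h
    obtain ⟨v, u, hvu⟩ := rank_one_of_det hd
    exact ⟨fun _ => v, fun _ => u, by simpa using hvu⟩

lemma exists_UV {n : ℕ} (d : Fin n → ℂ) (P : ℂ → Matrix (Fin 2) (Fin 2) ℂ)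
    (h : ∀ σ ∈ Finset.univ.image d, (Finset.univ.filter fun k => d k = σ).card = 2 ∨
      ((Finset.univ.filter fun k => d k = σ).card = 1 ∧ (P σ).det = 0)) :
    ∃ U V : Matrix (Fin n) (Fin 2) ℂ, ∀ f : ℂ → ℂ,
      Vᵀ * (Matrix.diagonal (fun k => f (d k)) * U) = ∑ σ ∈ Finset.univ.image d, f σ • P σ := by
  classical
  have h' : ∀ σ, ∃ v u : Fin n → Fin 2 → ℂ, σ ∈ Finset.univ.image d →
      ∑ k ∈ Finset.univ.filter (fun k => d k = σ), Matrix.vecMulVec (v k) (u k) = P σ := by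
    intro σ
    by_cases hσ : σ ∈ Finset.univ.image d
    · obtain ⟨v, u, hvu⟩ := fiber_factor _ (P σ) (h σ hσ)
      exact ⟨v, u, fun _ => hvu⟩
    · exact ⟨0, 0, fun hh => absurd hh hσ⟩
  choose v u hvu using h'
  refine ⟨Matrix.of fun k => u (d k) k, Matrix.of fun k => v (d k) k, fun f => ?_⟩
  have : ∑ σ ∈ Finset.univ.image d, f σ • P σ =
      ∑ k, f (d k) • Matrix.vecMulVec (v (d k) k) (u (d k) k) := by
    rw [← Finset.sum_fiberwise_of_maps_to
      (fun k _ => Finset.mem_image_of_mem d (Finset.mem_univ k))]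
    refine Finset.sum_congr rfl fun σ hσ => ?_
    rw [← hvu σ hσ, Finset.smul_sum]
    refine Finset.sum_congr rfl fun k hk => ?_
    rw [(Finset.mem_filter.1 hk).2]
  rw [this]
  ext i j
  rw [Matrix.sum_apply, Matrix.mul_apply]
  refine Finset.sum_congr rfl fun k _ => ?_
  rw [Matrix.diagonal_mul]
  simp [Matrix.vecMulVec_apply]
  ring

lemma evCounts_card {n : ℕ} (d : Fin n → ℂ) (m : ℕ) :
    ((Finset.univ.image d).filter
      (fun σ => (Finset.univ.filter fun k => d k = σ).card = m)).card = (evCounts d).count m := by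
  classical
  unfold evCounts
  rw [Multiset.count_map, Finset.card_def, Finset.filter_val]
  congr 1
  convert Multiset.filter_congr (fun x _ => eq_comm) using 2

lemma evCounts_mem {n : ℕ} (d : Fin n → ℂ) (σ : ℂ) (h : σ ∈ Finset.univ.image d) :
    (Finset.univ.filter fun k => d k = σ).card ∈ evCounts d := by
  classical
  unfold evCounts
  rw [Multiset.mem_map]
  refine ⟨σ, ?_, by congr⟩
  rw [Finset.mem_val]
  convert h

lemma sum_fib {n : ℕ} (d : Fin n → ℂ) :
    ∑ i, d i = ∑ σ ∈ Finset.univ.image d, ((Finset.univ.filter fun k => d k = σ).card : ℂ) * σ := by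
  classical
  rw [← Finset.sum_fiberwise_of_maps_to
      (fun k _ => Finset.mem_image_of_mem d (Finset.mem_univ k))]
  refine Finset.sum_congr rfl fun σ _ => ?_
  rw [Finset.sum_congr rfl fun k hk => (Finset.mem_filter.1 hk).2, Finset.sum_const, nsmul_eq_mul]

lemma evCounts_three {n m : ℕ} (d : Fin n → ℂ) (h : evCounts d = {m, 1, 1}) :
    ∃ c α β : ℂ, c ≠ α ∧ c ≠ β ∧ α ≠ β ∧ Finset.univ.image d = {c, α, β} ∧
      (Finset.univ.filter fun k => d k = c).card = m ∧
      (Finset.univ.filter fun k => d k = α).card = 1 ∧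
      (Finset.univ.filter fun k => d k = β).card = 1 := by
  classical
  have h2 : (Finset.univ.image d).val.map
      (fun σ => (Finset.univ.filter fun k => d k = σ).card) = m ::ₘ 1 ::ₘ {1} := by
    rw [← (show evCounts d = m ::ₘ 1 ::ₘ {1} from h)]
    unfold evCounts
    congr!
  obtain ⟨c, hc, hcm, h3⟩ := (Multiset.map_eq_cons _ _ _ _).2 h2
  obtain ⟨α, hα, hα1, h4⟩ := (Multiset.map_eq_cons _ _ _ _).2 h3
  obtain ⟨β, hβ, hβ1⟩ := Multiset.map_eq_singleton.1 h4
  have e2 := Multiset.cons_erase hα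
  have e1 := Multiset.cons_erase hc
  rw [hβ] at e2
  rw [← e2] at e1
  have hnd : (c ::ₘ α ::ₘ {β}).Nodup := by rw [e1]; exact Finset.nodup _
  simp only [Multiset.nodup_cons, Multiset.mem_cons, Multiset.mem_singleton, not_or] at hnd
  refine ⟨c, α, β, hnd.1.1, hnd.1.2, hnd.2.1, ?_, hcm, hα1, hβ1⟩
  ext x
  rw [← Finset.mem_val, ← e1]
  simp

lemma le_finrank_of_inj {n m : ℕ} (E : Submodule ℂ (Fin n → ℂ)) (f : (Fin m → ℂ) →ₗ[ℂ] (Fin n → ℂ))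
    (hf : Function.Injective f) (hE : ∀ x, f x ∈ E) : m ≤ Module.finrank ℂ E := by
  have := LinearMap.finrank_le_finrank_of_injective (f := f.codRestrict E hE)
    (fun x y hxy => hf (congrArg Subtype.val hxy))
  simpa using this

lemma one_le_finrank {n : ℕ} (E : Submodule ℂ (Fin n → ℂ)) (w : Fin n → ℂ) (hw : w ≠ 0)
    (h : w ∈ E) : 1 ≤ Module.finrank ℂ E := by
  rw [Nat.one_le_iff_ne_zero]
  intro h0
  rw [Submodule.finrank_eq_zero] at h0
  rw [h0] at h
  exact hw ((Submodule.mem_bot ℂ).1 h)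

/-- existence of the rigid series `OG_k`, `n = 2k+1`, PMV
`(2,…,2,1)` (`k` twos), `(2,…,2,1,1,1)` (`k-1` twos), `(2k-1,1,1)`. -/
theorem stmt12 (k : ℕ) (hk : 1 ≤ k) (n : ℕ) (hn : n = 2 * k + 1)
    (d : Fin 3 → Fin n → ℂ)
    (hmv0 : evCounts (d 0) = Multiset.replicate k 2 + {1})
    (hmv1 : evCounts (d 1) = Multiset.replicate (k - 1) 2 + Multiset.replicate 3 1)
    (hmv2 : evCounts (d 2) = ({2 * k - 1, 1, 1} : Multiset ℕ))
    (hsum : (∑ j, ∑ i, d j i) = 0)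
    (hgen : GenericAddEV d) :
    ∃ A : Fin 3 → Matrix (Fin n) (Fin n) ℂ,
      (∑ j, A j) = 0 ∧ IrreducibleTuple A ∧
      ∀ j, MatConj (Matrix.diagonal (d j)) (A j) := by
  classical
  obtain ⟨c, α, β, hcα, hcβ, hαβ, him, hmc, hmα, hmβ⟩ := evCounts_three (d 2) hmv2
  -- disjointness from genericity with one eigenvalue from each family
  have hdisj : ∀ i0 i1 i2, d 0 i0 + d 1 i1 + d 2 i2 ≠ 0 := by
    intro i0 i1 i2
    have := hgen 1 le_rfl (by omega) ![{i0}, {i1}, {i2}]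
      (by intro j; fin_cases j <;> simp)
    simpa [Fin.sum_univ_three] using this
  obtain ⟨ic, hic⟩ : ∃ i, d 2 i = c := by
    have : c ∈ Finset.univ.image (d 2) := by rw [him]; simp
    simpa using this
  -- first family
  set S := Finset.univ.image (d 0) with hS
  let cnt : (j : Fin 3) → ℂ → ℕ := fun j σ => (Finset.univ.filter fun k => d j k = σ).card
  have h0mem : ∀ σ ∈ S, cnt 0 σ = 2 ∨ cnt 0 σ = 1 := by
    intro σ hσ
    have := evCounts_mem (d 0) σ hσ
    rw [hmv0] at this
    simp only [Multiset.mem_add, Multiset.mem_singleton] at this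
    exact this.imp_left (fun h => Multiset.eq_of_mem_replicate h)
  have h01 : (S.filter (fun σ => cnt 0 σ = 1)).card = 1 := by
    refine (evCounts_card (d 0) 1).trans ?_
    rw [hmv0]; simp [Multiset.count_replicate]
  have h02 : (S.filter (fun σ => cnt 0 σ = 2)).card = k := by
    refine (evCounts_card (d 0) 2).trans ?_
    rw [hmv0]; simp [Multiset.count_replicate]
  obtain ⟨l0, hl0⟩ := Finset.card_eq_one.1 h01
  have h0not : S.filter (fun σ => ¬ cnt 0 σ = 1) = S.filter (fun σ => cnt 0 σ = 2) := by
    refine Finset.filter_congr fun σ hσ => ?_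
    rcases h0mem σ hσ with h | h <;> omega
  have hScard : S.card = k + 1 := by
    have := Finset.card_filter_add_card_filter_not (s := S) (fun σ => cnt 0 σ = 1)
    rw [h0not] at this
    omega
  have hS0sum : ∑ i, d 0 i = 2 * (∑ x ∈ S, x) - l0 := by
    have e1 := Finset.sum_filter_add_sum_filter_not S (fun σ => cnt 0 σ = 1)
      (fun σ => (cnt 0 σ : ℂ) * σ)
    have e2 := Finset.sum_filter_add_sum_filter_not S (fun σ => cnt 0 σ = 1) (fun σ => σ)
    rw [h0not, hl0, Finset.sum_singleton] at e1 e2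
    have e3 : ∑ σ ∈ S.filter (fun σ => cnt 0 σ = 2), (cnt 0 σ : ℂ) * σ
        = 2 * ∑ σ ∈ S.filter (fun σ => cnt 0 σ = 2), σ := by
      rw [Finset.mul_sum]
      exact Finset.sum_congr rfl fun σ hσ => by rw [(Finset.mem_filter.1 hσ).2]; norm_num
    have e4 : cnt 0 l0 = 1 := by
      have : l0 ∈ S.filter (fun σ => cnt 0 σ = 1) := by rw [hl0]; simp
      exact (Finset.mem_filter.1 this).2
    have e5 : ∑ i, d 0 i = ∑ σ ∈ S, (cnt 0 σ : ℂ) * σ := sum_fib (d 0)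
    rw [e5, ← e1, ← e2, e3, e4]; push_cast; ring
  -- second family
  set T := Finset.univ.image (d 1) with hT
  have h1mem : ∀ σ ∈ T, cnt 1 σ = 2 ∨ cnt 1 σ = 1 := by
    intro σ hσ
    have := evCounts_mem (d 1) σ hσ
    rw [hmv1] at this
    rw [Multiset.mem_add] at this
    exact this.imp (fun h => Multiset.eq_of_mem_replicate h)
      (fun h => Multiset.eq_of_mem_replicate h)
  have h11 : (T.filter (fun σ => cnt 1 σ = 1)).card = 3 := by
    refine (evCounts_card (d 1) 1).trans ?_
    rw [hmv1, Multiset.count_add]; simp [Multiset.count_replicate]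
  have h12 : (T.filter (fun σ => cnt 1 σ = 2)).card = k - 1 := by
    refine (evCounts_card (d 1) 2).trans ?_
    rw [hmv1, Multiset.count_add]; simp [Multiset.count_replicate]
  obtain ⟨t1, t2, t3, ht12, ht13, ht23, ht⟩ := Finset.card_eq_three.1 h11
  have h1not : T.filter (fun σ => ¬ cnt 1 σ = 1) = T.filter (fun σ => cnt 1 σ = 2) := by
    refine Finset.filter_congr fun σ hσ => ?_
    rcases h1mem σ hσ with h | h <;> omega
  set T2 := T.filter (fun σ => cnt 1 σ = 2) with hT2
  have hT1sum : ∑ i, d 1 i = 2 * (∑ x ∈ T2, x) + (t1 + t2 + t3) := by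
    have e1 := Finset.sum_filter_add_sum_filter_not T (fun σ => cnt 1 σ = 1)
      (fun σ => (cnt 1 σ : ℂ) * σ)
    have e3 : ∑ σ ∈ T2, (cnt 1 σ : ℂ) * σ = 2 * ∑ σ ∈ T2, σ := by
      rw [Finset.mul_sum]
      exact Finset.sum_congr rfl fun σ hσ => by rw [(Finset.mem_filter.1 hσ).2]; norm_num
    have e4 : ∑ σ ∈ T.filter (fun σ => cnt 1 σ = 1), (cnt 1 σ : ℂ) * σ = t1 + t2 + t3 := by
      rw [Finset.sum_congr rfl (g := fun σ => σ)
        (fun σ hσ => by rw [(Finset.mem_filter.1 hσ).2]; norm_num), ht,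
        Finset.sum_insert (by simp [ht12, ht13]), Finset.sum_pair ht23]
      ring
    have e5 : ∑ i, d 1 i = ∑ σ ∈ T, (cnt 1 σ : ℂ) * σ := sum_fib (d 1)
    rw [e5, ← e1, h1not, e3, e4]; ring
  -- third family
  have h2sum : ∑ i, d 2 i = (2 * (k : ℂ) - 1) * c + α + β := by
    rw [sum_fib, him, Finset.sum_insert (by simp [hcα, hcβ]), Finset.sum_pair hαβ, hmc, hmα, hmβ]
    rw [Nat.cast_sub (by omega)]; push_cast; ring
  have htot : 2 * (∑ x ∈ S, x) - l0 + (2 * (∑ x ∈ T2, x) + (t1 + t2 + t3)) +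
      ((2 * (k : ℂ) - 1) * c + α + β) = 0 := by
    rw [← hS0sum, ← hT1sum, ← h2sum, ← hsum, Fin.sum_univ_three]
  have hzS : ∀ τ ∈ T, -c - τ ∉ S := by
    intro τ hτ hmem
    obtain ⟨i1, -, rfl⟩ := Finset.mem_image.1 hτ
    obtain ⟨i0, -, h⟩ := Finset.mem_image.1 hmem
    refine hdisj i0 i1 ic ?_
    rw [h, hic]; ring
  have hinj : Function.Injective (fun τ : ℂ => -c - τ) := fun x y h => by
    simpa using h
  have htT : ∀ t, t = t1 ∨ t = t2 ∨ t = t3 → t ∈ T := by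
    intro t h
    have : t ∈ T.filter (fun σ => cnt 1 σ = 1) := by rw [ht]; simpa using h
    exact (Finset.mem_filter.1 this).1
  obtain ⟨P, hPsum, hPdet, hPT, hPn⟩ := exists_residues S (T2.image fun τ => -c - τ)
    (by rw [Finset.card_image_of_injective _ hinj, h12, hScard]; omega)
    l0 (-c - t1) (-c - t2) (-c - t3) (α - c) (β - c)
    (by intro h; exact hαβ (by linear_combination h))
    (by
      intro t ht
      obtain ⟨τ, hτ, rfl⟩ := Finset.mem_image.1 ht
      exact hzS τ (Finset.mem_filter.1 hτ).1)
    (hzS _ (htT _ (by simp))) (hzS _ (htT _ (by simp))) (hzS _ (htT _ (by simp)))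
    (by
      rw [Finset.sum_image (fun x _ y _ h => hinj h), Finset.sum_sub_distrib, Finset.sum_const,
        h12, nsmul_eq_mul, Nat.cast_sub hk]
      push_cast
      linear_combination htot)
  obtain ⟨U, V, hUV⟩ := exists_UV (d 0) P (by
    intro σ hσ
    rcases h0mem σ hσ with h | h
    · exact Or.inl h
    · refine Or.inr ⟨h, ?_⟩
      have : σ ∈ S.filter (fun σ => cnt 0 σ = 1) := Finset.mem_filter.2 ⟨hσ, h⟩
      rw [hl0, Finset.mem_singleton] at this
      rw [this]; exact hPdet)
  have hVU : Vᵀ * U = !![α - c, 0; 0, β - c] := by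
    have := hUV (fun _ => 1)
    rw [Matrix.diagonal_one, Matrix.one_mul] at this
    rw [this, ← hPsum]
    simp [hS]
  let A : Fin 3 → Matrix (Fin n) (Fin n) ℂ := ![Matrix.diagonal (d 0),
    -(c • 1) - Matrix.diagonal (d 0) - U * Vᵀ, c • 1 + U * Vᵀ]
  have hA : ∑ j, A j = 0 := by
    rw [Fin.sum_univ_three]
    show Matrix.diagonal (d 0) + (-(c • 1) - Matrix.diagonal (d 0) - U * Vᵀ) + (c • 1 + U * Vᵀ) = 0
    abel
  -- eigenvectors of the second matrix
  let L : ℂ → Matrix (Fin n) (Fin 2) ℂ := fun z =>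
    Matrix.diagonal (fun i => (z - d 0 i)⁻¹) * U
  have hL : ∀ τ ∈ T, ∀ x : Fin 2 → ℂ,
      (1 - ∑ s ∈ S, ((-c - τ) - s)⁻¹ • P s) *ᵥ x = 0 →
      Vᵀ *ᵥ (L (-c - τ) *ᵥ x) = x ∧ A 1 *ᵥ (L (-c - τ) *ᵥ x) = τ • (L (-c - τ) *ᵥ x) := by
    intro τ hτ x hx
    have e1 : Vᵀ *ᵥ (L (-c - τ) *ᵥ x) = x := by
      rw [Matrix.mulVec_mulVec, hUV (fun s => ((-c - τ) - s)⁻¹)]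
      rw [Matrix.sub_mulVec, Matrix.one_mulVec, sub_eq_zero] at hx
      exact hx.symm
    refine ⟨e1, ?_⟩
    have hA1 : A 1 = -(c • 1) - Matrix.diagonal (d 0) - U * Vᵀ := rfl
    rw [hA1, Matrix.sub_mulVec, Matrix.sub_mulVec, ← Matrix.mulVec_mulVec _ U Vᵀ, e1, Matrix.neg_mulVec,
      Matrix.smul_mulVec, Matrix.one_mulVec]
    have e2 : ∀ i, (U *ᵥ x) i = ((-c - τ) - d 0 i) * (L (-c - τ) *ᵥ x) i := by
      intro i
      have hne : (-c - τ) - d 0 i ≠ 0 := by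
        intro h
        refine hzS τ hτ ?_
        rw [sub_eq_zero.1 h]
        exact Finset.mem_image_of_mem _ (Finset.mem_univ i)
      simp only [L]
      rw [← Matrix.mulVec_mulVec, Matrix.mulVec_diagonal, mul_inv_cancel_left₀ hne]
    ext i
    simp only [Pi.sub_apply, Pi.neg_apply, Pi.smul_apply, smul_eq_mul, Matrix.mulVec_diagonal, e2]
    ring
  have hconj : ∀ j, MatConj (Matrix.diagonal (d j)) (A j) := by
    intro j
    fin_cases j
    · exact ⟨1, by simp [A]⟩
    · apply matConj_of_finrank
      intro i
      have hi : d 1 i ∈ T := Finset.mem_image_of_mem _ (Finset.mem_univ i)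
      rcases h1mem _ hi with h | h
      · refine (le_of_eq h).trans ?_
        have hz := hPT (-c - d 1 i) (Finset.mem_image_of_mem _ (Finset.mem_filter.2 ⟨hi, h⟩))
        have hx := fun x => hL (d 1 i) hi x (by rw [hz, Matrix.zero_mulVec])
        refine le_finrank_of_inj _ (Matrix.mulVecLin (L (-c - d 1 i))) ?_ ?_
        · intro x y hxy
          rw [← (hx x).1, ← (hx y).1]
          exact congrArg (fun w => Vᵀ *ᵥ w) hxy
        · intro x
          rw [Module.End.mem_eigenspace_iff]
          exact (hx x).2
      · refine (le_of_eq h).trans ?_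
        have hm : d 1 i ∈ T.filter (fun σ => cnt 1 σ = 1) := Finset.mem_filter.2 ⟨hi, h⟩
        rw [ht] at hm
        have hdet := hPn (-c - d 1 i) (by
          simp only [Finset.mem_insert, Finset.mem_singleton] at hm
          rcases hm with h | h | h <;> simp [h])
        obtain ⟨x, hx0, hx⟩ := Matrix.exists_mulVec_eq_zero_iff.2 hdet
        obtain ⟨e1, e2⟩ := hL (d 1 i) hi x hx
        refine one_le_finrank _ (L (-c - d 1 i) *ᵥ x) ?_ ?_
        · intro h0
          rw [h0, Matrix.mulVec_zero] at e1
          exact hx0 e1.symm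
        · rw [Module.End.mem_eigenspace_iff]
          exact e2
    · apply matConj_of_finrank
      intro i
      have hi : d 2 i ∈ ({c, α, β} : Finset ℂ) := by
        rw [← him]; exact Finset.mem_image_of_mem _ (Finset.mem_univ i)
      have hA2 : ∀ w, A 2 *ᵥ w = c • w + U *ᵥ (Vᵀ *ᵥ w) := by
        intro w
        have : A 2 = c • 1 + U * Vᵀ := rfl
        rw [this, Matrix.add_mulVec, Matrix.smul_mulVec, Matrix.one_mulVec, Matrix.mulVec_mulVec]
      have hev : ∀ γ : ℂ, γ ≠ 0 → ∀ x : Fin 2 → ℂ, x ≠ 0 → (Vᵀ * U) *ᵥ x = γ • x →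
          1 ≤ Module.finrank ℂ (Module.End.eigenspace (Matrix.mulVecLin (A 2)) (c + γ)) := by
        intro γ hγ x hx hxe
        refine one_le_finrank _ (U *ᵥ x) ?_ ?_
        · intro h0
          rw [← Matrix.mulVec_mulVec, h0, Matrix.mulVec_zero] at hxe
          exact (smul_ne_zero hγ hx) hxe.symm
        · rw [Module.End.mem_eigenspace_iff, Matrix.mulVecLin_apply, hA2,
            Matrix.mulVec_mulVec x Vᵀ U, hxe, Matrix.mulVec_smul, add_smul]
      simp only [Finset.mem_insert, Finset.mem_singleton] at hi
      show (Finset.univ.filter fun k => d 2 k = d 2 i).card ≤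
        Module.finrank ℂ (Module.End.eigenspace (Matrix.mulVecLin (A 2)) (d 2 i))
      rcases hi with h | h | h
      · rw [h, hmc]
        have hker : LinearMap.ker (Matrix.mulVecLin Vᵀ) ≤
            Module.End.eigenspace (Matrix.mulVecLin (A 2)) c := by
          intro w hw
          rw [LinearMap.mem_ker, Matrix.mulVecLin_apply] at hw
          rw [Module.End.mem_eigenspace_iff, Matrix.mulVecLin_apply, hA2, hw, Matrix.mulVec_zero,
            add_zero]
        have h1 := Submodule.finrank_mono hker
        have h2 := LinearMap.finrank_range_add_finrank_ker (Matrix.mulVecLin Vᵀ)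
        have h3 := Submodule.finrank_le (LinearMap.range (Matrix.mulVecLin Vᵀ))
        simp only [Module.finrank_fin_fun] at h2 h3
        omega
      · rw [h, hmα]
        have := hev (α - c) (sub_ne_zero.2 hcα.symm) ![1, 0]
          (fun h => by simpa using congrFun h 0)
          (by rw [hVU]; ext i; fin_cases i <;> simp)
        rwa [add_sub_cancel] at this
      · rw [h, hmβ]
        have := hev (β - c) (sub_ne_zero.2 hcβ.symm) ![0, 1]
          (fun h => by simpa using congrFun h 1)
          (by rw [hVU]; ext i; fin_cases i <;> simp)
        rwa [add_sub_cancel] at this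
  exact ⟨A, hA, irreducible_of_generic d hgen A hA hconj, hconj⟩
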